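/- arXiv:1606.00961 — 3 statements merged into one kernel-verified Lean document; each statement's English description precedes it below -/
import Mathlib

section
/- Let I be a finite index set, let k ∈ I, and let B : I × I → ℤ be an integer matrix with B[k,k] = 0. Let K be a field and let (A_j)_{j∈I} be nonzero elements of K. Set X_i = ∏_{j∈I} A_j^{B[i,j]}. Let P = ∏_{j : B[k,j] > 0} A_j^{B[k,j]} and N = ∏_{j : B[k,j] < 0} A_j^{−B[k,j]}, and assume P + N ≠ 0. Define A'_k = (P + N)/A_k and A'_j = A_j for j ≠ k (the cluster exchange relation), let B' = μ_k(B) be the mutated matrix, and set X'_i = ∏_{j∈I} (A'_j)^{B'[i,j]}. Then X'_k = X_k^{−1}, and for every i ≠ k, X'_i = X_i · X_k^{max(B[i,k],0)} · (1 + X_k)^{−B[i,k]}. (This is the compatibility asserted in the paper: the ensemble map p, defined by p*(X_i) = ∏_j A_j^{B_{ij}}, intertwines the mutation of A-coordinates with the mutation of X-coordinates, i.e. the square p ∘ μ_k = μ_k ∘ p commutes.) -/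
/-- Matrix mutation at an index `k` (integer entries):
`μ_k(B)[i,j] = -B[i,j]` if `i = k` or `j = k`;
`μ_k(B)[i,j] = B[i,j] + |B[i,k]|·B[k,j]` if `B[i,k]·B[k,j] > 0`;
`μ_k(B)[i,j] = B[i,j]` otherwise. -/
def mutateZ {I : Type*} [DecidableEq I] (B : I → I → ℤ) (k : I) : I → I → ℤ :=
  fun i j =>
    if i = k ∨ j = k then -B i j
    else if 0 < B i k * B k j then B i j + |B i k| * B k j
    else B i j

/-- The ensemble map `p*(X_i) = ∏_j A_j^{B[i,j]}` intertwines the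
cluster exchange relation for the `A`-coordinates with the `X`-coordinate
mutation rule: after mutation at `k` one has `X'_k = X_k⁻¹` and, for `i ≠ k`,
`X'_i = X_i · X_k^{max(B[i,k],0)} · (1 + X_k)^{-B[i,k]}`. -/
theorem ensemble_map_intertwines_mutation
    {I : Type*} [Fintype I] [DecidableEq I] (k : I) (B : I → I → ℤ)
    (hBkk : B k k = 0) (K : Type*) [Field K] (A : I → K) (hA : ∀ j, A j ≠ 0)
    (X : I → K) (hX : ∀ i, X i = ∏ j, A j ^ B i j)
    (P N : K)
    (hP : P = ∏ j ∈ Finset.univ.filter (fun j => 0 < B k j), A j ^ B k j)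
    (hN : N = ∏ j ∈ Finset.univ.filter (fun j => B k j < 0), A j ^ (-B k j))
    (hPN : P + N ≠ 0)
    (A' : I → K) (hA' : ∀ j, A' j = if j = k then (P + N) / A k else A j)
    (X' : I → K) (hX' : ∀ i, X' i = ∏ j, A' j ^ mutateZ B k i j) :
    X' k = (X k)⁻¹ ∧
      ∀ i, i ≠ k →
        X' i = X i * X k ^ max (B i k) 0 * (1 + X k) ^ (-B i k) := by
  have hP0 : P ≠ 0 := by
    rw [hP]; exact Finset.prod_ne_zero_iff.mpr fun j _ => zpow_ne_zero _ (hA j)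
  have hN0 : N ≠ 0 := by
    rw [hN]; exact Finset.prod_ne_zero_iff.mpr fun j _ => zpow_ne_zero _ (hA j)
  have hXk : X k = P / N := by
    rw [hX, hP, hN, div_eq_mul_inv, ← Finset.prod_inv_distrib, Finset.prod_filter,
      Finset.prod_filter, ← Finset.prod_mul_distrib]
    refine Finset.prod_congr rfl fun j _ => ?_
    rcases lt_trichotomy (B k j) 0 with h | h | h
    · simp [h, h.le, not_lt.mpr h.le]
    · simp [h]
    · simp [h, not_lt.mpr h.le]
  constructor
  · rw [hX', hX, ← Finset.prod_inv_distrib]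
    refine Finset.prod_congr rfl fun j _ => ?_
    by_cases h : j = k
    · subst h; simp [mutateZ, hBkk]
    · simp [mutateZ, hA', h]
  · intro i hi
    have key : X' i = X i * (P + N) ^ (-B i k) *
        ∏ j, (if 0 < B i k * B k j then A j ^ (|B i k| * B k j) else 1) := by
      have h1 : (P + N) ^ (-B i k) = ∏ j, (if j = k then (P + N) ^ (-B i k) else 1) := by
        simp
      rw [h1, hX', hX, ← Finset.prod_mul_distrib, ← Finset.prod_mul_distrib]
      refine Finset.prod_congr rfl fun j _ => ?_
      by_cases h : j = k
      · subst h
        simp [mutateZ, hBkk, hA', div_zpow, div_eq_mul_inv, mul_zpow, mul_comm]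
      · by_cases h2 : 0 < B i k * B k j
        · simp [mutateZ, hA', h, hi, h2, zpow_add₀ (hA j)]
        · simp [mutateZ, hA', h, hi, h2]
    have h1X : 1 + X k = (P + N) / N := by
      rw [hXk]; field_simp; ring
    rw [key, h1X, hXk]
    rcases lt_trichotomy (B i k) 0 with h | h | h
    · have e : ∏ j, (if 0 < B i k * B k j then A j ^ (|B i k| * B k j) else 1)
          = N ^ (B i k) := by
        rw [hN, Finset.prod_filter, ← Finset.prod_zpow]
        refine Finset.prod_congr rfl fun j _ => ?_
        have : 0 < B i k * B k j ↔ B k j < 0 :=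
          ⟨fun hh => by by_contra hc; nlinarith, fun hh => mul_pos_of_neg_of_neg h hh⟩
        simp only [this]
        split_ifs
        · rw [← zpow_mul, abs_of_neg h]; congr 1; ring
        · simp
      rw [e, max_eq_right h.le, zpow_zero, div_zpow, zpow_neg N, div_inv_eq_mul]
      simp [mul_assoc]
    · simp [h]
    · have e : ∏ j, (if 0 < B i k * B k j then A j ^ (|B i k| * B k j) else 1)
          = P ^ (B i k) := by
        rw [hP, Finset.prod_filter, ← Finset.prod_zpow]
        refine Finset.prod_congr rfl fun j _ => ?_
        simp only [mul_pos_iff_of_pos_left h]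
        split_ifs
        · rw [← zpow_mul, abs_of_pos h]; congr 1; ring
        · simp
      rw [e, max_eq_left h.le, div_zpow, div_zpow, zpow_neg N]
      have := zpow_ne_zero (B i k) hN0
      field_simp
end

section
/- For n ≥ 2, let V_n and the type-A_{n−1} triangle exchange matrix B be as defined in the context. Define ω : {0,…,n} → ℚ^{n−1} by ω₀ = ω_n = 0 and ω_m = the m-th standard basis vector for 1 ≤ m ≤ n−1 (representing the fundamental weights of SL_n), let α_m = 2ω_m − ω_{m−1} − ω_{m+1} for 1 ≤ m ≤ n−1 (the simple roots), and assign to each vertex v = (i,j,k) ∈ V_n the weight triple W(v) = (ω_i, ω_j, ω_k) ∈ ℚ^{n−1} × ℚ^{n−1} × ℚ^{n−1}. Then: (1) for every v = (i,j,k) ∈ V_n with i, j, k all positive (the unfrozen vertices), Σ_{w ∈ V_n} B[v,w]·W(w) = (0,0,0); and (2) for every v = (i,0,k) ∈ V_n (an edge vertex, so i, k ≥ 1 and i + k = n), Σ_{w ∈ V_n} B[v,w]·W(w) = (−α_i/2, 0, α_k/2). (Part (1) is the paper's condition guaranteeing that the X-coordinates at unfrozen vertices descend to Conf₃ B; part (2)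 verifies the paper's Conjecture on edge weights — that S_{AB,C,ω_k} has weight α_k/2 at one endpoint and w₀(α_k)/2 = −α_{k*}/2 at the other — in type A.) -/
/-- `v − w ∈ {(1,−1,0), (−1,0,1), (0,1,−1)}`, written additively over ℕ. -/
def TriAdj (v w : ℕ × ℕ × ℕ) : Prop :=
  (v.1 = w.1 + 1 ∧ w.2.1 = v.2.1 + 1 ∧ v.2.2 = w.2.2) ∨
  (w.1 = v.1 + 1 ∧ v.2.2 = w.2.2 + 1 ∧ v.2.1 = w.2.1) ∨
  (v.2.1 = w.2.1 + 1 ∧ w.2.2 = v.2.2 + 1 ∧ v.1 = w.1)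

instance (v w : ℕ × ℕ × ℕ) : Decidable (TriAdj v w) := by
  unfold TriAdj; infer_instance

/-- `v` and `w` have a zero in a common coordinate. -/
def CommonZero (v w : ℕ × ℕ × ℕ) : Prop :=
  (v.1 = 0 ∧ w.1 = 0) ∨ (v.2.1 = 0 ∧ w.2.1 = 0) ∨ (v.2.2 = 0 ∧ w.2.2 = 0)

instance (v w : ℕ × ℕ × ℕ) : Decidable (CommonZero v w) := by
  unfold CommonZero; infer_instance

/-- The type-`A_{n−1}` triangle exchange matrix. -/
def TriB (v w : ℕ × ℕ × ℕ) : ℚ :=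
  if TriAdj v w then (if CommonZero v w then 1/2 else 1)
  else if TriAdj w v then (if CommonZero v w then -(1/2) else -1)
  else 0

/-- The index set `V_n` as a finite set: triples of naturals summing to `n`
with the three corners removed. -/
def Vset (n : ℕ) : Finset (ℕ × ℕ × ℕ) :=
  ((Finset.range (n + 1)) ×ˢ (Finset.range (n + 1)) ×ˢ (Finset.range (n + 1))).filter
    (fun v => v.1 + v.2.1 + v.2.2 = n ∧ v ≠ (n, 0, 0) ∧ v ≠ (0, n, 0) ∧ v ≠ (0, 0, n))

/-- The fundamental weights of `SL_n` (with `ω 0 = ω n = 0`), as vectors in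
`ℚ^{n-1}`: `ω m` is the `m`-th standard basis vector for `1 ≤ m ≤ n−1`. -/
def omg (n m : ℕ) : Fin (n - 1) → ℚ := fun t => if t.val + 1 = m then 1 else 0

/-- The simple roots `α_m = 2ω_m − ω_{m−1} − ω_{m+1}` of `SL_n`. -/
def alph (n m : ℕ) : Fin (n - 1) → ℚ :=
  fun t => 2 * omg n m t - omg n (m - 1) t - omg n (m + 1) t

/-- The weight triple `W(i,j,k) = (ω_i, ω_j, ω_k)` attached to a vertex. -/
def Wt (n : ℕ) (v : ℕ × ℕ × ℕ) :
    (Fin (n - 1) → ℚ) × (Fin (n - 1) → ℚ) × (Fin (n - 1) → ℚ) :=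
  (omg n v.1, omg n v.2.1, omg n v.2.2)

theorem Wt_eq_zero (n : ℕ) (w : ℕ × ℕ × ℕ) (hs : w.1 + w.2.1 + w.2.2 = n) (hw : w ∉ Vset n) :
    Wt n w = 0 := by
  obtain ⟨a, b, c⟩ := w
  simp only at hs
  have h : ∀ m, m = 0 ∨ m = n → omg n m = 0 := by
    intro m hm
    funext t
    have := t.isLt
    simp only [omg, Pi.zero_apply]
    rw [if_neg]
    omega
  have hc : (a = 0 ∨ a = n) ∧ (b = 0 ∨ b = n) ∧ (c = 0 ∨ c = n) := by
    simp only [Vset, Finset.mem_filter, Finset.mem_product, Finset.mem_range, ne_eq,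
      Prod.mk.injEq] at hw
    omega
  simp [Wt, h a hc.1, h b hc.2.1, h c hc.2.2]

theorem sum_Vset_eq (n : ℕ) (v : ℕ × ℕ × ℕ) (T : Finset (ℕ × ℕ × ℕ))
    (hT : ∀ w ∈ T, w.1 + w.2.1 + w.2.2 = n)
    (hA : ∀ w, TriAdj v w ∨ TriAdj w v → w ∈ T) :
    ∑ w ∈ Vset n, TriB v w • Wt n w = ∑ w ∈ T, TriB v w • Wt n w := by
  apply Finset.sum_congr_of_eq_on_inter
  · intro w _ hw
    have h1 : ¬ TriAdj v w := fun h => hw (hA w (Or.inl h))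
    have h2 : ¬ TriAdj w v := fun h => hw (hA w (Or.inr h))
    simp [TriB, h1, h2]
  · intro w hw hn
    rw [Wt_eq_zero n w (hT w hw) hn, smul_zero]
  · intros
    rfl

/-- For the type-`A_{n−1}` triangle seed: (1) at every unfrozen
vertex `v` (all coordinates positive) the weighted sum
`Σ_w B[v,w]·W(w)` vanishes; (2) at every edge vertex `v = (i,0,k)` one has
`Σ_w B[v,w]·W(w) = (−α_i/2, 0, α_k/2)`. -/
theorem typeA_weights_balance
    (n : ℕ) (hn : 2 ≤ n) :
    (∀ v ∈ Vset n, 0 < v.1 → 0 < v.2.1 → 0 < v.2.2 →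
      ∑ w ∈ Vset n, TriB v w • Wt n w = 0) ∧
    (∀ i k : ℕ, 1 ≤ i → 1 ≤ k → i + k = n →
      ∑ w ∈ Vset n, TriB (i, 0, k) w • Wt n w
        = (((-1 : ℚ)/2) • alph n i, 0, ((1 : ℚ)/2) • alph n k)) := by
  constructor
  · rintro ⟨i, j, k⟩ hv hi hj hk
    have hs : i + j + k = n := by
      simp only [Vset, Finset.mem_filter] at hv
      exact hv.2.1
    simp only at hi hj hk
    obtain ⟨a, rfl⟩ := Nat.exists_eq_add_of_lt hi
    obtain ⟨b, rfl⟩ := Nat.exists_eq_add_of_lt hj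
    obtain ⟨c, rfl⟩ := Nat.exists_eq_add_of_lt hk
    simp only [zero_add] at *
    rw [sum_Vset_eq n _ {(a, b + 2, c + 1), (a + 2, b + 1, c), (a + 1, b, c + 2),
      (a + 2, b, c + 1), (a, b + 1, c + 2), (a + 1, b + 2, c)}]
    · simp [TriB, TriAdj, CommonZero, Wt]
      try abel_nf
      try simp
    · intro w hw
      simp only [Finset.mem_insert, Finset.mem_singleton] at hw
      rcases hw with rfl | rfl | rfl | rfl | rfl | rfl <;> simp only <;> omega
    · rintro ⟨x, y, z⟩ h
      simp only [TriAdj] at h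
      simp only [Finset.mem_insert, Finset.mem_singleton, Prod.mk.injEq]
      rcases h with (h | h | h) | (h | h | h)
      · exact Or.inl ⟨by omega, by omega, by omega⟩
      · exact Or.inr (Or.inl ⟨by omega, by omega, by omega⟩)
      · exact Or.inr (Or.inr (Or.inl ⟨by omega, by omega, by omega⟩))
      · exact Or.inr (Or.inr (Or.inr (Or.inl ⟨by omega, by omega, by omega⟩)))
      · exact Or.inr (Or.inr (Or.inr (Or.inr (Or.inl ⟨by omega, by omega, by omega⟩))))
      · exact Or.inr (Or.inr (Or.inr (Or.inr (Or.inr (⟨by omega, by omega, by omega⟩)))))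
  · intro i k hi hk hs
    obtain ⟨a, rfl⟩ := Nat.exists_eq_add_of_le' hi
    obtain ⟨c, rfl⟩ := Nat.exists_eq_add_of_le' hk
    rw [sum_Vset_eq n _ {(a, 1, c + 1), (a + 2, 0, c), (a, 0, c + 2), (a + 1, 1, c)}]
    · simp [TriB, TriAdj, CommonZero, Wt]
      refine ⟨?_, ?_⟩ <;> funext t <;> simp [alph] <;> ring
    · intro w hw
      simp only [Finset.mem_insert, Finset.mem_singleton] at hw
      rcases hw with rfl | rfl | rfl | rfl <;> simp only <;> omega
    · rintro ⟨x, y, z⟩ h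
      simp only [TriAdj] at h
      simp only [Finset.mem_insert, Finset.mem_singleton, Prod.mk.injEq]
      omega
end

section
/- Let B be the G₂ quadrilateral seed matrix defined in the context, indexed by the 22-element set I. Apply mutations successively at the eighteen indices x₀ᵃ; x₋₁ᵃ, x₀ᵇ, x₁ᵃ; x₋₂ᵃ, x₋₁ᵇ, x₀ᵃ, x₁ᵇ, x₂ᵃ; x₋₂ᵇ, x₋₁ᵃ, x₀ᵇ, x₁ᵃ, x₂ᵇ; x₋₁ᵇ, x₀ᵃ, x₁ᵇ; x₀ᵇ (in this order), obtaining the matrix B'. Let σ : I → I be the involution with σ(xₘᵃ) = xₘᵇ and σ(xₘᵇ) = xₘᵃ for all −3 ≤ m ≤ 3, and σ(y₊ᵃ) = y₋ᵇ, σ(y₋ᵇ) = y₊ᵃ, σ(y₋ᵃ) = y₊ᵇ, σ(y₊ᵇ) = y₋ᵃ. Then B'[σ(i), σ(j)] = B[j,i] for all i, j ∈ I. (This is the paper's sequence of mutations realizing the flip of triangulation of the quadrilateral on Conf₄ A_{G₂}: the resulting seed is identified, via the Langlands-duality/transpose identification σ, with the seed attached to the other triangulation; σ preserves the set of frozen indices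 and exchanges the multipliers 1 ↔ 3.) -/
/-- The 22-element index set of the `G₂` quadrilateral seed on `Conf₄ A_{G₂}`:
vertices `xₘᵃ = xa t`, `xₘᵇ = xb t` where the subscript is `m = t − 3` for
`t : Fin 7` (so `m ∈ {−3,…,3}`), together with `y₊ᵃ, y₋ᵃ, y₊ᵇ, y₋ᵇ`. -/
inductive QIdx
  | xa (t : Fin 7) | xb (t : Fin 7) | ypa | yma | ypb | ymb
  deriving DecidableEq, Repr

/-- Matrix mutation at an index `k`:
`μ_k(B)[i,j] = -B[i,j]` if `i = k` or `j = k`;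
`μ_k(B)[i,j] = B[i,j] + |B[i,k]|·B[k,j]` if `B[i,k]·B[k,j] > 0`;
`μ_k(B)[i,j] = B[i,j]` otherwise. -/
def mutateQ {I : Type*} [DecidableEq I] (B : I → I → ℚ) (k : I) : I → I → ℚ :=
  fun i j =>
    if i = k ∨ j = k then -B i j
    else if 0 < B i k * B k j then B i j + |B i k| * B k j
    else B i j

/-- The subscript `m = t − 3 ∈ {−3,…,3}` of a vertex index `t : Fin 7`. -/
def mval (t : Fin 7) : ℤ := (t.val : ℤ) - 3

/-- Entries of the quadrilateral seed matrix within a single row of `a`-type or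
`b`-type vertices: the weight-(1,1) arrows `x₁→x₀, x₂→x₁, x₃→x₂` and
`x₋₁→x₀, x₋₂→x₋₁, x₋₃→x₋₂`.  `chainEnt t u` is the `(xₜ, xᵤ)`-entry. -/
def chainEnt (t u : Fin 7) : ℚ :=
  if (mval u = mval t + 1 ∧ 0 < mval u) ∨ (mval u = mval t - 1 ∧ mval u < 0) then 1
  else if (mval t = mval u + 1 ∧ 0 < mval t) ∨ (mval t = mval u - 1 ∧ mval t < 0) then -1
  else 0

/-- The `(xₜᵃ, xᵤᵇ)`-entry: weight-(1,3) arrows `xₘᵇ → x_{m+1}ᵃ` (`m = 0,1,2`)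
and `xₘᵇ → x_{m−1}ᵃ` (`m = 0,−1,−2`) contribute `1`; weight-(3,1) arrows
`xₘᵃ → xₘᵇ` (`m = 0,±1,±2`) contribute `−1`; the weight-(3/2,1/2) dashed
arrows `x₃ᵃ → x₃ᵇ`, `x₋₃ᵃ → x₋₃ᵇ` contribute `−1/2`. -/
def crossABEnt (t u : Fin 7) : ℚ :=
  if (mval t = mval u + 1 ∧ 0 ≤ mval u) ∨ (mval t = mval u - 1 ∧ mval u ≤ 0) then 1
  else if t = u then (if mval t = 3 ∨ mval t = -3 then -1/2 else -1)
  else 0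

/-- The `(xₜᵇ, xᵤᵃ)`-entry (see `crossABEnt`). -/
def crossBAEnt (t u : Fin 7) : ℚ :=
  if (mval u = mval t + 1 ∧ 0 ≤ mval t) ∨ (mval u = mval t - 1 ∧ mval t ≤ 0) then -3
  else if t = u then (if mval t = 3 ∨ mval t = -3 then 3/2 else 3)
  else 0

/-- The `G₂` quadrilateral seed matrix: the exchange matrix of the cluster seed
on `Conf₄ A_{G₂}` attached to the triangulation `ABC, ACD` (omitting the two
inert dashed arrows between `y₊ᵇ, y₊ᵃ` and between `y₋ᵇ, y₋ᵃ`).  An arrow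
`w → v` of weight `(p,q)` means `B[v,w] = p` and `B[w,v] = −q`.  The frozen
indices are `{x₃ᵃ, x₃ᵇ, x₋₃ᵃ, x₋₃ᵇ, y₊ᵃ, y₋ᵃ, y₊ᵇ, y₋ᵇ}`. -/
def QB : QIdx → QIdx → ℚ := fun i j =>
  match i, j with
  | .xa t, .xa u => chainEnt t u
  | .xb t, .xb u => chainEnt t u
  | .xa t, .xb u => crossABEnt t u
  | .xb t, .xa u => crossBAEnt t u
  | .ypa, .xa t => if mval t = 0 then 1 else if mval t = 1 then -1 else 0
  | .xa t, .ypa => if mval t = 0 then -1 else if mval t = 1 then 1 else 0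
  | .yma, .xa t => if mval t = 0 then 1 else if mval t = -1 then -1 else 0
  | .xa t, .yma => if mval t = 0 then -1 else if mval t = -1 then 1 else 0
  | .ypb, .xb t => if mval t = 2 then 1 else if mval t = 3 then -1 else 0
  | .xb t, .ypb => if mval t = 2 then -1 else if mval t = 3 then 1 else 0
  | .ymb, .xb t => if mval t = -2 then 1 else if mval t = -3 then -1 else 0
  | .xb t, .ymb => if mval t = -2 then -1 else if mval t = -3 then 1 else 0
  | _, _ => 0

/-- The involution `σ` with `σ(xₘᵃ) = xₘᵇ`, `σ(xₘᵇ) = xₘᵃ`, `σ(y₊ᵃ) = y₋ᵇ`,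
`σ(y₋ᵇ) = y₊ᵃ`, `σ(y₋ᵃ) = y₊ᵇ`, `σ(y₊ᵇ) = y₋ᵃ`. -/
def flipSigma : QIdx → QIdx := fun i =>
  match i with
  | .xa t => .xb t
  | .xb t => .xa t
  | .ypa => .ymb | .ymb => .ypa
  | .yma => .ypb | .ypb => .yma

namespace G2Flip

/-- Code of an index as a natural number below `18`. -/
def enc : QIdx → ℕ
  | .xa t => t.val
  | .xb t => 7 + t.val
  | .ypa => 14 | .yma => 15 | .ypb => 16 | .ymb => 17

/-- All indices. -/
def allIdx : List QIdx :=
  (List.finRange 7).map .xa ++ (List.finRange 7).map .xb ++ [.ypa, .yma, .ypb, .ymb]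

theorem mem_allIdx (i : QIdx) : i ∈ allIdx := by
  cases i <;> simp [allIdx]

theorem enc_lt (i : QIdx) : enc i < 18 := by
  cases i <;> simp only [enc] <;> omega

theorem enc_inj {i j : QIdx} (h : enc i = enc j) : i = j := by
  have H : ∀ i ∈ allIdx, ∀ j ∈ allIdx, enc i = enc j → i = j := by decide +kernel
  exact H i (mem_allIdx i) j (mem_allIdx j) h

/-- Scaling factors: `2` on the four frozen vertices `x₃, x₋₃`, and `1` elsewhere. -/
def scale : QIdx → ℤ
  | .xa t => if t = 0 ∨ t = 6 then 2 else 1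
  | .xb t => if t = 0 ∨ t = 6 then 2 else 1
  | _ => 1

theorem scale_pos (i : QIdx) : 0 < scale i := by
  cases i <;> simp only [scale] <;> first | (split <;> norm_num) | norm_num

theorem scale_flip (i : QIdx) : scale (flipSigma i) = scale i := by
  cases i <;> rfl

abbrev Mat := List (List ℤ)

def get (M : Mat) (i j : ℕ) : ℤ := (M.getD i []).getD j 0

def tab (f : ℕ → ℕ → ℤ) : Mat :=
  (List.range 18).map fun i => (List.range 18).map (f i)

theorem get_tab (f : ℕ → ℕ → ℤ) {i j : ℕ} (hi : i < 18) (hj : j < 18) :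
    get (tab f) i j = f i j := by
  simp [get, tab, List.getD, hi, hj]

/-- Integer mutation. -/
def step (M : Mat) (k : ℕ) : Mat :=
  tab fun i j =>
    if i = k ∨ j = k then -get M i j
    else if 0 < get M i k * get M k j then get M i j + |get M i k| * get M k j
    else get M i j

/-- Evaluate an integer before passing it on. -/
def forceInt {β : Type} (x : ℤ) (c : ℤ → β) : β :=
  match x with
  | .ofNat 0 => c 0
  | .ofNat (n + 1) => c (.ofNat (n + 1))
  | .negSucc 0 => c (.negSucc 0)
  | .negSucc (n + 1) => c (.negSucc (n + 1))

theorem forceInt_eq {β : Type} (x : ℤ) (c : ℤ → β) : forceInt x c = c x := by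
  unfold forceInt; split <;> rfl

/-- Evaluate a list before passing it on. -/
def forceList {α β : Type} (f : α → (α → β) → β) : List α → (List α → β) → β
  | [], c => c []
  | x :: l, c => f x fun y => forceList f l fun l' => c (y :: l')

theorem forceList_eq {α β : Type} (f : α → (α → β) → β) (hf : ∀ x c, f x c = c x)
    (l : List α) (c : List α → β) : forceList f l c = c l := by
  induction l generalizing c with
  | nil => rfl
  | cons x l ih => simp [forceList, hf, ih]

def forceMat {β : Type} (M : Mat) (c : Mat → β) : β :=
  forceList (forceList forceInt) M c

theorem forceMat_eq {β : Type} (M : Mat) (c : Mat → β) : forceMat M c = c M :=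
  forceList_eq _ (forceList_eq _ forceInt_eq) M c

/-- Run a sequence of mutations, then test the result. -/
def run (M : Mat) (p : Mat → Bool) : List ℕ → Bool
  | [] => p M
  | k :: ks => forceMat (step M k) fun M' => run M' p ks

theorem run_eq (M : Mat) (p : Mat → Bool) (ks : List ℕ) :
    run M p ks = p (ks.foldl step M) := by
  induction ks generalizing M with
  | nil => rfl
  | cons k ks ih => simp [run, forceMat_eq, ih]

/-- `M` represents the rescaled matrix `B`. -/
def Rep (M : Mat) (B : QIdx → QIdx → ℚ) : Prop :=
  ∀ i j, (get M (enc i) (enc j) : ℚ) = scale i * scale j * B i j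

theorem rep_step {M : Mat} {B : QIdx → QIdx → ℚ} (h : Rep M B) (k : QIdx)
    (hk : scale k = 1) : Rep (step M (enc k)) (mutateQ B k) := by
  intro i j
  have hi : (0 : ℚ) < scale i := by exact_mod_cast scale_pos i
  have hj : (0 : ℚ) < scale j := by exact_mod_cast scale_pos j
  have hij := h i j
  have hik := h i k
  have hkj := h k j
  rw [hk] at hik hkj
  simp only [Int.cast_one, mul_one, one_mul] at hik hkj
  rw [step, get_tab _ (enc_lt i) (enc_lt j), mutateQ]
  have e1 : (enc i = enc k ∨ enc j = enc k) ↔ (i = k ∨ j = k) :=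
    or_congr ⟨enc_inj, congrArg _⟩ ⟨enc_inj, congrArg _⟩
  have e2 : 0 < get M (enc i) (enc k) * get M (enc k) (enc j) ↔ 0 < B i k * B k j := by
    rw [← Int.cast_pos (R := ℚ), Int.cast_mul, hik, hkj,
      show (scale i : ℚ) * B i k * (scale j * B k j)
        = (scale i * scale j) * (B i k * B k j) by ring]
    exact mul_pos_iff_of_pos_left (mul_pos hi hj)
  simp only [e1, e2]
  split_ifs
  · push_cast; rw [hij]; ring
  · push_cast; rw [hij, hik, hkj, abs_mul, abs_of_pos hi]; ring
  · exact hij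

theorem rep_foldl (ks : List QIdx) (hks : ∀ k ∈ ks, scale k = 1) {M : Mat}
    {B : QIdx → QIdx → ℚ} (h : Rep M B) :
    Rep ((ks.map enc).foldl step M) (ks.foldl mutateQ B) := by
  induction ks generalizing M B with
  | nil => exact h
  | cons k ks ih =>
    exact ih (fun l hl => hks l (List.mem_cons_of_mem _ hl))
      (rep_step h k (hks k List.mem_cons_self))

/-- The initial rescaled integer matrix. -/
def init : Mat :=
  allIdx.map fun i => allIdx.map fun j => (scale i * scale j * QB i j : ℚ).num

theorem rep_init : Rep init QB := by
  have H : ∀ i ∈ allIdx, ∀ j ∈ allIdx,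
      (get init (enc i) (enc j) : ℚ) = scale i * scale j * QB i j := by decide +kernel
  exact fun i j => H i (mem_allIdx i) j (mem_allIdx j)

def seq : List QIdx :=
  [QIdx.xa 3,
    QIdx.xa 2, QIdx.xb 3, QIdx.xa 4,
    QIdx.xa 1, QIdx.xb 2, QIdx.xa 3, QIdx.xb 4, QIdx.xa 5,
    QIdx.xb 1, QIdx.xa 2, QIdx.xb 3, QIdx.xa 4, QIdx.xb 5,
    QIdx.xb 2, QIdx.xa 3, QIdx.xb 4,
    QIdx.xb 3]

def test (M' : Mat) : Bool :=
  allIdx.all fun i => allIdx.all fun j =>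
    get M' (enc (flipSigma i)) (enc (flipSigma j)) == get init (enc j) (enc i)

theorem run_test : forceMat init (fun M => run M test (seq.map enc)) = true := by
  decide +kernel

end G2Flip

/-- The eighteen-step mutation sequence
`x₀ᵃ; x₋₁ᵃ, x₀ᵇ, x₁ᵃ; x₋₂ᵃ, x₋₁ᵇ, x₀ᵃ, x₁ᵇ, x₂ᵃ; x₋₂ᵇ, x₋₁ᵃ, x₀ᵇ, x₁ᵃ, x₂ᵇ;
x₋₁ᵇ, x₀ᵃ, x₁ᵇ; x₀ᵇ` realizing the flip of triangulation on `Conf₄ A_{G₂}`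
transforms the quadrilateral seed matrix `B` into a matrix `B'` with
`B'[σ(i), σ(j)] = B[j, i]` for all `i, j`. -/
theorem G2_flip_mutation_sequence :
    ∀ i j : QIdx,
      (List.foldl mutateQ QB
        [QIdx.xa 3,
         QIdx.xa 2, QIdx.xb 3, QIdx.xa 4,
         QIdx.xa 1, QIdx.xb 2, QIdx.xa 3, QIdx.xb 4, QIdx.xa 5,
         QIdx.xb 1, QIdx.xa 2, QIdx.xb 3, QIdx.xa 4, QIdx.xb 5,
         QIdx.xb 2, QIdx.xa 3, QIdx.xb 4,
         QIdx.xb 3])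
        (flipSigma i) (flipSigma j) = QB j i := by
  intro i j
  have hrun := G2Flip.run_test
  rw [G2Flip.forceMat_eq, G2Flip.run_eq] at hrun
  have hrep := G2Flip.rep_foldl G2Flip.seq (by decide +kernel) G2Flip.rep_init
  have h1 := hrep (flipSigma i) (flipSigma j)
  have h2 := G2Flip.rep_init j i
  simp only [G2Flip.test, List.all_eq_true, beq_iff_eq] at hrun
  rw [hrun i (G2Flip.mem_allIdx i) j (G2Flip.mem_allIdx j), h2, G2Flip.scale_flip,
    G2Flip.scale_flip] at h1
  have hi : (G2Flip.scale i : ℚ) ≠ 0 := by exact_mod_cast (G2Flip.scale_pos i).ne'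
  have hj : (G2Flip.scale j : ℚ) ≠ 0 := by exact_mod_cast (G2Flip.scale_pos j).ne'
  rw [mul_comm (G2Flip.scale j : ℚ)] at h1
  exact (mul_left_cancel₀ (mul_ne_zero hi hj) h1).symm
end
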